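/- A henselian valued field (K,v) of characteristic p>0 is algebraically maximal if and only if (K,v) is O-extremal with respect to every p-polynomial in one variable with coefficients in K. -/

import Mathlib

open scoped Classical

noncomputable section

namespace ValuedDefect

universe u v

variable {K : Type u} {L : Type v} [Field K] [Field L]

/-- The ramification index `(vL : vK)`: the index of the image of `Kˣ` in the
value group `Lˣ / Bˣ` of the valuation subring `B` of `L`. -/
def ramIndex (K : Type u) {L : Type v} [Field K] [Field L] [Algebra K L]
    (B : ValuationSubring L) : ℕ :=
  (Subgroup.map (QuotientGroup.mk' B.unitGroup)
    (MonoidHom.range (Units.map (algebraMap K L).toMonoidHom))).index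

/-- The ring homomorphism `A →+* B` induced by `algebraMap K L` when `B` lies above `A`. -/
def valHom [Algebra K L] (A : ValuationSubring K) (B : ValuationSubring L)
    (h : B.comap (algebraMap K L) = A) : A →+* B where
  toFun x := ⟨algebraMap K L x, by
    have hx : (x : K) ∈ B.comap (algebraMap K L) := by rw [h]; exact x.2
    exact ValuationSubring.mem_comap.mp hx⟩
  map_one' := Subtype.ext (by simp)
  map_mul' x y := Subtype.ext (by simp)
  map_zero' := Subtype.ext (by simp)
  map_add' x y := Subtype.ext (by simp)

theorem valHom_isLocalHom [Algebra K L] (A : ValuationSubring K) (B : ValuationSubring L)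
    (h : B.comap (algebraMap K L) = A) : IsLocalHom (valHom A B h) := by
  constructor
  intro x hx
  rcases isUnit_iff_exists_inv.mp hx with ⟨y, hy⟩
  have hy' : algebraMap K L (x : K) * (y : L) = 1 := congrArg Subtype.val hy
  have hx0 : (x : K) ≠ 0 := by
    rintro h0
    rw [h0, map_zero, zero_mul] at hy'
    exact zero_ne_one hy'
  have hyx : (y : L) = algebraMap K L ((x : K)⁻¹) := by
    rw [map_inv₀]
    exact eq_inv_of_mul_eq_one_right hy'
  have hmem : ((x : K)⁻¹ : K) ∈ A := by
    have hB : algebraMap K L ((x : K)⁻¹) ∈ B := hyx ▸ y.2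
    have := ValuationSubring.mem_comap.mpr hB
    rwa [h] at this
  refine isUnit_iff_exists_inv.mpr ⟨⟨(x : K)⁻¹, hmem⟩, Subtype.ext ?_⟩
  exact mul_inv_cancel₀ hx0

/-- The residue degree `[Lv : Kv]` of an extension of valuation subrings. -/
def residueDegree [Algebra K L] (A : ValuationSubring K) (B : ValuationSubring L) : ℕ :=
  if h : B.comap (algebraMap K L) = A then
    letI := valHom_isLocalHom A B h
    letI := (IsLocalRing.ResidueField.map (valHom A B h)).toAlgebra
    Module.finrank (IsLocalRing.ResidueField A) (IsLocalRing.ResidueField B)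
  else 0

/-- A finite extension of valued fields (with unique extension of the valuation) is
defectless if `[L : K] = (vL : vK) · [Lv : Kv]`. -/
def IsDefectless [Algebra K L] (A : ValuationSubring K) (B : ValuationSubring L) : Prop :=
  Module.finrank K L = ramIndex K B * residueDegree A B

/-- An extension of valued fields is immediate if `vL = vK` and `Lv = Kv`. -/
def IsImmediate (K : Type u) {L : Type v} [Field K] [Field L] [Algebra K L]
    (B : ValuationSubring L) : Prop :=
  (∀ x : L, x ≠ 0 → ∃ c : K, B.valuation x = B.valuation (algebraMap K L c)) ∧
  ∀ x : L, B.valuation x ≤ 1 → ∃ c : K, B.valuation (x - algebraMap K L c) < 1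

/-- A valued field is a defectless field if every finite extension is defectless. -/
def IsDefectlessField {K : Type u} [Field K] (A : ValuationSubring K) : Prop :=
  ∀ (L : Type u) [Field L] [Algebra K L], FiniteDimensional K L →
    ∀ B : ValuationSubring L, B.comap (algebraMap K L) = A → IsDefectless A B

/-- A valued field is a separably defectless field if every finite separable extension is
defectless. -/
def IsSepDefectlessField {K : Type u} [Field K] (A : ValuationSubring K) : Prop :=
  ∀ (L : Type u) [Field L] [Algebra K L], FiniteDimensional K L → Algebra.IsSeparable K L →
    ∀ B : ValuationSubring L, B.comap (algebraMap K L) = A → IsDefectless A B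

/-- A valued field is inseparably defectless if every finite purely inseparable extension is
defectless. -/
def IsInsepDefectless {K : Type u} [Field K] (A : ValuationSubring K) : Prop :=
  ∀ (L : Type u) [Field L] [Algebra K L], FiniteDimensional K L → IsPurelyInseparable K L →
    ∀ B : ValuationSubring L, B.comap (algebraMap K L) = A → IsDefectless A B

/-- A valued field is algebraically maximal if it admits no proper immediate algebraic
extension. -/
def IsAlgMaximal {K : Type u} [Field K] (A : ValuationSubring K) : Prop :=
  ∀ (L : Type u) [Field L] [Algebra K L], Algebra.IsAlgebraic K L →
    ∀ B : ValuationSubring L, B.comap (algebraMap K L) = A → IsImmediate K B →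
      Function.Surjective (algebraMap K L)

/-- A valued field is separable-algebraically maximal if it admits no proper immediate
separable-algebraic extension. -/
def IsSepAlgMaximal {K : Type u} [Field K] (A : ValuationSubring K) : Prop :=
  ∀ (L : Type u) [Field L] [Algebra K L], Algebra.IsAlgebraic K L → Algebra.IsSeparable K L →
    ∀ B : ValuationSubring L, B.comap (algebraMap K L) = A → IsImmediate K B →
      Function.Surjective (algebraMap K L)

/-- `(K,v)` is `K`-extremal with respect to `f` if the set `{v f(a) : a ∈ K}` has a maximum
(in the multiplicative convention: a minimum). -/
def KExtremal (A : ValuationSubring K) (f : Polynomial K) : Prop :=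
  ∃ a : K, ∀ b : K, A.valuation (f.eval a) ≤ A.valuation (f.eval b)

/-- `(K,v)` is `O`-extremal with respect to `f` if the set `{v f(a) : a ∈ O}` has a maximum. -/
def OExtremal (A : ValuationSubring K) (f : Polynomial K) : Prop :=
  ∃ a : A, ∀ b : A, A.valuation (f.eval (a : K)) ≤ A.valuation (f.eval (b : K))

/-- `K`-extremality for multivariable polynomials. -/
def KExtremalMv (A : ValuationSubring K) {n : ℕ} (f : MvPolynomial (Fin n) K) : Prop :=
  ∃ a : Fin n → K, ∀ b : Fin n → K,
    A.valuation (MvPolynomial.eval a f) ≤ A.valuation (MvPolynomial.eval b f)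

/-- A `p`-polynomial: an additive polynomial plus a constant. -/
def IsPPolynomial (p : ℕ) (f : Polynomial K) : Prop :=
  ∃ (c : K) (m : ℕ) (co : ℕ → K),
    f = Polynomial.C c + ∑ i ∈ Finset.range (m + 1), Polynomial.C (co i) * Polynomial.X ^ p ^ i

/-- A field of characteristic `p > 0` is Artin-Schreier closed if every polynomial
`X^p - X - a` has a root. -/
def ASClosed (K : Type*) [Field K] (p : ℕ) : Prop :=
  ∀ a : K, ∃ x : K, x ^ p - x = a

/-- The subfield `K^p` of `p`-th powers of a field of characteristic `p`. -/
def pPowerSubfield (K : Type*) [Field K] (p : ℕ) (hp : p.Prime) [CharP K p] : Subfield K :=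
  haveI : Fact p.Prime := ⟨hp⟩
  (frobenius K p).fieldRange

/-- The field `K^{1/p}` of `p`-th roots of `K` inside a purely inseparable extension `P`. -/
def pthRootField (K : Type u) (P : Type v) [Field K] [Field P] [Algebra K P]
    (p : ℕ) (hp : p.Prime) [CharP K p] : IntermediateField K P :=
  haveI : Fact p.Prime := ⟨hp⟩
  haveI : CharP P p := charP_of_injective_algebraMap (algebraMap K P).injective p
  { carrier := {x : P | x ^ p ∈ (algebraMap K P).range}
    mul_mem' := fun {a b} ha hb => by
      rcases ha with ⟨c, hc⟩
      rcases hb with ⟨d, hd⟩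
      exact ⟨c * d, by rw [map_mul, hc, hd, mul_pow]⟩
    one_mem' := ⟨1, by rw [map_one, one_pow]⟩
    add_mem' := fun {a b} ha hb => by
      rcases ha with ⟨c, hc⟩
      rcases hb with ⟨d, hd⟩
      exact ⟨c + d, by rw [map_add, hc, hd, add_pow_char]⟩
    zero_mem' := ⟨0, by rw [map_zero, zero_pow hp.ne_zero]⟩
    algebraMap_mem' := fun r => ⟨r ^ p, by rw [map_pow]⟩
    inv_mem' := fun x hx => by
      rcases hx with ⟨c, hc⟩
      exact ⟨c⁻¹, by rw [map_inv₀, hc, inv_pow]⟩ }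

/-- A (possibly infinite) algebraic extension of valued fields is defectless if every finite
subextension is defectless. -/
def IsDefectlessAlgExt {K : Type u} {L : Type v} [Field K] [Field L] [Algebra K L]
    (A : ValuationSubring K) (B : ValuationSubring L) : Prop :=
  ∀ E : IntermediateField K L, FiniteDimensional K E →
    IsDefectless A (B.comap (algebraMap E L))

open Polynomial IntermediateField

section Valuation

theorem valuation_algebraMap_le_iff [Algebra K L] {A : ValuationSubring K}
    {B : ValuationSubring L} (h : B.comap (algebraMap K L) = A) (x y : K) :
    B.valuation (algebraMap K L x) ≤ B.valuation (algebraMap K L y) ↔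
      A.valuation x ≤ A.valuation y := by
  by_cases hy : y = 0
  · subst hy
    simp
  · have hy' : algebraMap K L y ≠ 0 := by simpa using hy
    rw [← div_le_one₀ (zero_lt_iff.mpr (B.valuation.ne_zero_iff.mpr hy')),
      ← div_le_one₀ (zero_lt_iff.mpr (A.valuation.ne_zero_iff.mpr hy)), ← map_div₀, ← map_div₀,
      ← map_div₀, ValuationSubring.valuation_le_one_iff, ValuationSubring.valuation_le_one_iff,
      ← h, ValuationSubring.mem_comap]

/-- Every valuation ring of a field extends to any extension field. -/
theorem exists_valuationSubring_comap_eq [Algebra K L] (A : ValuationSubring K) :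
    ∃ B : ValuationSubring L, B.comap (algebraMap K L) = A := by
  obtain ⟨B, hB, hloc⟩ :=
    IsLocalRing.exists_factor_valuationRing ((algebraMap K L).comp A.subtype)
  refine ⟨B, le_antisymm (fun x hx => ?_) fun x hx => hB ⟨x, hx⟩⟩
  by_contra hxA
  have hx0 : x ≠ 0 := fun h => hxA (h ▸ A.zero_mem)
  have hinv : x⁻¹ ∈ A := (A.mem_or_inv_mem x).resolve_left hxA
  have hu : IsUnit (⟨x⁻¹, hinv⟩ : A) := by
    apply hloc.map_nonunit
    refine isUnit_iff_exists_inv.mpr ⟨⟨algebraMap K L x, hx⟩, Subtype.ext ?_⟩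
    change algebraMap K L x⁻¹ * algebraMap K L x = 1
    rw [← map_mul, inv_mul_cancel₀ hx0, map_one]
  obtain ⟨y, hy⟩ := isUnit_iff_exists_inv.mp hu
  have hy' : x⁻¹ * (y : K) = 1 := congrArg Subtype.val hy
  exact hxA ((inv_mul_eq_one₀ hx0).mp hy' ▸ y.2)

theorem valuation_prod_sub_prod_lt {Γ : Type*} [LinearOrderedCommGroupWithZero Γ]
    (w : Valuation L Γ) (a s : L) (M : Multiset L) (hM : ∀ t ∈ M, w (a - s) < w (s - t)) :
    w ((M.map fun t => a - t).prod - (M.map fun t => s - t).prod) <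
      w (M.map fun t => s - t).prod := by
  induction M using Multiset.induction_on with
  | empty => simp
  | cons t M ih =>
    have ih := ih fun u hu => hM u (Multiset.mem_cons_of_mem hu)
    have ht := hM t (Multiset.mem_cons_self t M)
    have hat : w (a - t) = w (s - t) := by
      rw [← sub_add_sub_cancel a s t, w.map_add_eq_of_lt_right ht]
    have hpos : 0 < w (s - t) := zero_le.trans_lt ht
    have hpos' : 0 < w (M.map fun t => s - t).prod := zero_le.trans_lt ih
    rw [Multiset.map_cons, Multiset.map_cons, Multiset.prod_cons, Multiset.prod_cons]
    have key : (a - t) * (M.map fun t => a - t).prod - (s - t) * (M.map fun t => s - t).prod =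
        (a - t) * ((M.map fun t => a - t).prod - (M.map fun t => s - t).prod) +
          (a - s) * (M.map fun t => s - t).prod := by ring
    rw [key, map_mul]
    refine w.map_add_lt ?_ ?_
    · rw [map_mul, hat]
      exact mul_lt_mul_of_pos_left ih hpos
    · rw [map_mul]
      exact mul_lt_mul_of_pos_right ht hpos'

end Valuation

section Maximal

/-- It suffices to approximate every element to leading order in an immediate extension. -/
theorem isImmediate_of_forall_exists_sub_lt [Algebra K L] {B : ValuationSubring L}
    (h : ∀ x : L, x ≠ 0 → ∃ c : K, B.valuation (x - algebraMap K L c) < B.valuation x) :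
    IsImmediate K B := by
  refine ⟨fun x hx => ?_, fun x hx => ?_⟩
  · obtain ⟨c, hc⟩ := h x hx
    refine ⟨c, ?_⟩
    rw [← B.valuation.map_sub_eq_of_lt_left hc, sub_sub_cancel]
  · by_cases hx0 : x = 0
    · exact ⟨0, by simp [hx0]⟩
    · obtain ⟨c, hc⟩ := h x hx0
      exact ⟨c, hc.trans_le hx⟩

/-- Over an algebraically maximal field, every algebraic element has a best approximation in the
valuation ring. -/
theorem IsAlgMaximal.exists_best_approx {Ω : Type u} [Field Ω] [Algebra K Ω] [IsAlgClosed Ω]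
    [Algebra.IsAlgebraic K Ω] {A : ValuationSubring K} (hA : IsAlgMaximal A)
    {B : ValuationSubring Ω} (hB : B.comap (algebraMap K Ω) = A) (r : Ω) :
    ∃ a : A, ∀ b : A, B.valuation (algebraMap K Ω a - r) ≤ B.valuation (algebraMap K Ω b - r) := by
  by_contra! hr
  set w := B.valuation with hw
  let T : Set Ω := {s | ∀ a : A, w (s - r) < w (algebraMap K Ω a - r)}
  have hrT : r ∈ T := fun a => by
    obtain ⟨b, hb⟩ := hr a
    rw [sub_self, map_zero]
    exact zero_le.trans_lt hb
  have hwA : ∀ a : A, w (algebraMap K Ω a) ≤ 1 := fun a => by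
    rw [hw, ValuationSubring.valuation_le_one_iff, ← ValuationSubring.mem_comap, hB]
    exact a.2
  obtain ⟨s, hsT, hmin⟩ := exists_minimalFor_of_wellFoundedLT (· ∈ T)
    (fun s => (minpoly K s).natDegree) ⟨r, hrT⟩
  have hs : ∀ a : A, w (algebraMap K Ω a - s) = w (algebraMap K Ω a - r) := fun a => by
    rw [← sub_sub_sub_cancel_right _ s r, w.map_sub_eq_of_lt_left (hsT a)]
  have hsint : IsIntegral K s := Algebra.IsIntegral.isIntegral s
  have happrox : ∀ M : Multiset Ω, (∀ t ∈ M, t ∉ T) →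
      ∃ a : A, ∀ t ∈ M, w (algebraMap K Ω a - r) < w (t - r) := fun M => by
    induction M using Multiset.induction_on with
    | empty => exact fun _ => ⟨0, by simp⟩
    | cons t M ih =>
      intro hM
      obtain ⟨a, ha⟩ := ih fun u hu => hM u (Multiset.mem_cons_of_mem hu)
      have ht : ∃ b : A, w (algebraMap K Ω b - r) ≤ w (t - r) := by
        simpa [T] using hM t (Multiset.mem_cons_self t M)
      obtain ⟨b, hb⟩ := ht
      obtain ⟨b', hb'⟩ := hr b
      rcases le_total (w (algebraMap K Ω a - r)) (w (algebraMap K Ω b' - r)) with hle | hle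
      · refine ⟨a, fun u hu => ?_⟩
        rcases Multiset.mem_cons.mp hu with rfl | hu
        · exact hle.trans_lt (hb'.trans_le hb)
        · exact ha u hu
      · refine ⟨b', fun u hu => ?_⟩
        rcases Multiset.mem_cons.mp hu with rfl | hu
        · exact hb'.trans_le hb
        · exact hle.trans_lt (ha u hu)
  have himm : IsImmediate K (B.comap (algebraMap K⟮s⟯ Ω)) := by
    refine isImmediate_of_forall_exists_sub_lt fun x hx => ?_
    have hx' : (x : Ω) ∈ K⟮s⟯.toSubalgebra := x.2
    rw [IntermediateField.adjoin_simple_toSubalgebra_of_isAlgebraic hsint.isAlgebraic,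
      Algebra.adjoin_singleton_eq_range_aeval] at hx'
    obtain ⟨g₀, hg₀⟩ := hx'
    let g := g₀ %ₘ minpoly K s
    have hg : aeval s g = x := by
      rw [← hg₀]
      exact Polynomial.aeval_modByMonic_eq_self_of_root (minpoly.aeval K s)
    have hg0 : g ≠ 0 := by
      intro h
      rw [h, map_zero] at hg
      exact hx (Subtype.ext hg.symm)
    have hdeg : g.natDegree < (minpoly K s).natDegree :=
      Polynomial.natDegree_modByMonic_lt g₀ (minpoly.monic hsint) (minpoly.ne_one K s)
    have hsplit := fun y : Ω => Polynomial.Splits.aeval_eq_prod_aroots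
      (IsAlgClosed.splits (g.map (algebraMap K Ω))) y
    obtain ⟨a, ha⟩ := happrox (g.aroots Ω) fun t ht htT => by
      have h1 : minpoly K t ∣ g := minpoly.dvd K t (Polynomial.mem_aroots.mp ht).2
      have h2 := Polynomial.natDegree_le_of_dvd h1 hg0
      have h3 := hmin htT
      rcases le_total (minpoly K s).natDegree (minpoly K t).natDegree with h | h
      · omega
      · have : (minpoly K s).natDegree ≤ (minpoly K t).natDegree := h3 h
        omega
    have hlt := valuation_prod_sub_prod_lt w (algebraMap K Ω a) s (g.aroots Ω) fun t ht => by
      rw [hs, ← sub_sub_sub_cancel_right s t r, w.map_sub_eq_of_lt_right ((hsT a).trans (ha t ht))]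
      exact ha t ht
    refine ⟨g.eval (a : K), ?_⟩
    rw [← not_le]
    have hlc : 0 < w (algebraMap K Ω g.leadingCoeff) := by
      rw [zero_lt_iff, Valuation.ne_zero_iff]
      simpa using hg0
    have hfin : w (x - algebraMap K Ω (g.eval (a : K))) < w x := by
      rw [← Polynomial.aeval_algebraMap_apply_eq_algebraMap_eval, ← hg, w.map_sub_swap, hsplit,
        hsplit, ← mul_sub, map_mul, map_mul]
      exact mul_lt_mul_of_pos_left hlt hlc
    intro hle
    refine hfin.not_ge ?_
    exact (valuation_algebraMap_le_iff (K := K⟮s⟯) (L := Ω) (B := B) rfl _ _).mpr hle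
  obtain ⟨c, hc⟩ := hA K⟮s⟯ inferInstance (B.comap (algebraMap K⟮s⟯ Ω)) (by rw [← hB]; rfl) himm
    ⟨s, IntermediateField.mem_adjoin_simple_self K s⟩
  have hc' : algebraMap K Ω c = s := congrArg Subtype.val hc
  have hr1 : w r ≤ 1 := by
    obtain ⟨b, hb⟩ := hr 0
    by_contra! h
    have h1 : w (algebraMap K Ω b - r) = w r :=
      w.map_sub_eq_of_lt_right ((hwA b).trans_lt h)
    rw [h1] at hb
    simp at hb
  have hcA : c ∈ A := by
    rw [← hB, ValuationSubring.mem_comap, ← ValuationSubring.valuation_le_one_iff, hc',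
      ← sub_add_cancel s r]
    refine w.map_add_le ?_ hr1
    simpa using ((hsT 0).le.trans (by simpa using hr1))
  exact (hsT ⟨c, hcA⟩).ne (by rw [← hc'])

theorem IsAlgMaximal.oExtremal {A : ValuationSubring K} (hA : IsAlgMaximal A) (f : K[X]) :
    OExtremal A f := by
  by_cases hf : f = 0
  · exact ⟨0, fun b => by simp [hf]⟩
  let Ω := AlgebraicClosure K
  obtain ⟨B, hB⟩ := exists_valuationSubring_comap_eq (L := Ω) A
  choose best hbest using hA.exists_best_approx hB
  set w := B.valuation
  obtain ⟨b₀, -, hb₀⟩ := Finset.exists_min_image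
    (insert 0 ((f.aroots Ω).toFinset.image best)) (fun b : A => A.valuation (f.eval (b : K)))
    (Finset.insert_nonempty _ _)
  refine ⟨b₀, fun a => ?_⟩
  by_cases hroots : (f.aroots Ω).toFinset.Nonempty
  · obtain ⟨t₀, ht₀, hnear⟩ := Finset.exists_min_image (f.aroots Ω).toFinset
      (fun t => w (algebraMap K Ω (best t) - algebraMap K Ω a)) hroots
    refine (hb₀ (best t₀) (Finset.mem_insert_of_mem (Finset.mem_image_of_mem _ ht₀))).trans ?_
    have hsplit := fun y : Ω => Polynomial.Splits.aeval_eq_prod_aroots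
      (IsAlgClosed.splits (f.map (algebraMap K Ω))) y
    rw [← valuation_algebraMap_le_iff hB, ← Polynomial.aeval_algebraMap_apply_eq_algebraMap_eval,
      ← Polynomial.aeval_algebraMap_apply_eq_algebraMap_eval, hsplit, hsplit, map_mul, map_mul]
    refine mul_le_mul_right ?_ _
    rw [map_multiset_prod, map_multiset_prod, Multiset.map_map, Multiset.map_map]
    refine Multiset.prod_map_le_prod_map₀ _ _ (fun _ _ => zero_le) fun t ht => ?_
    have h1 : w (algebraMap K Ω (best t) - algebraMap K Ω a) ≤ w (algebraMap K Ω a - t) := by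
      rw [← sub_sub_sub_cancel_right _ _ t]
      exact w.map_sub_le (hbest t a) le_rfl
    change w (algebraMap K Ω (best t₀) - t) ≤ w (algebraMap K Ω a - t)
    rw [← sub_add_sub_cancel _ (algebraMap K Ω a) t]
    exact w.map_add_le ((hnear t (Multiset.mem_toFinset.mpr ht)).trans h1) le_rfl
  · have hempty : f.aroots Ω = 0 := by
      simpa [Finset.not_nonempty_iff_eq_empty] using hroots
    have hsplit := fun y : Ω => Polynomial.Splits.aeval_eq_prod_aroots
      (IsAlgClosed.splits (f.map (algebraMap K Ω))) y
    rw [← valuation_algebraMap_le_iff hB, ← Polynomial.aeval_algebraMap_apply_eq_algebraMap_eval,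
      ← Polynomial.aeval_algebraMap_apply_eq_algebraMap_eval, hsplit, hsplit, hempty]
    simp

end Maximal

section FixedPoints

variable [Algebra K L] [IsAlgClosed L] [Algebra.IsAlgebraic K L]

/-- An element fixed by all automorphisms is purely inseparable. -/
theorem exists_pow_mem_range_of_forall_algEquiv_eq (p : ℕ) [ExpChar K p] {x : L}
    (hx : ∀ σ : L ≃ₐ[K] L, σ x = x) :
    ∃ e₀, ∀ e, e₀ ≤ e → x ^ p ^ e ∈ (algebraMap K L).range := by
  have hint : IsIntegral K x := Algebra.IsIntegral.isIntegral x
  have : IsAlgClosure K L := ⟨inferInstance, inferInstance⟩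
  have : Normal K L := IsAlgClosure.normal K L
  have hroots : ((minpoly K x).aroots L).toFinset = {x} := by
    ext y
    rw [Multiset.mem_toFinset, Finset.mem_singleton,
      Polynomial.mem_aroots']
    constructor
    · rintro ⟨-, hy⟩
      obtain ⟨σ, hσ⟩ := isConjRoot_iff_exists_algEquiv.mp
        ((isConjRoot_iff_aeval_eq_zero hint).mpr hy)
      rw [← hx σ.symm, ← hσ, AlgEquiv.symm_apply_apply]
    · rintro rfl
      exact ⟨(Polynomial.map_ne_zero_iff (algebraMap K L).injective).mpr (minpoly.ne_zero hint),
        minpoly.aeval K y⟩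
  have hmem : x ∈ perfectClosure K L := by
    rw [mem_perfectClosure_iff_natSepDegree_eq_one, Polynomial.natSepDegree_eq_of_isAlgClosed L,
      hroots, Finset.card_singleton]
  obtain ⟨e₀, he₀⟩ := (mem_perfectClosure_iff_pow_mem p).mp hmem
  refine ⟨e₀, fun e he => ?_⟩
  obtain ⟨d, rfl⟩ := Nat.exists_eq_add_of_le he
  rw [pow_add, pow_mul]
  exact Subring.pow_mem _ he₀ _

theorem exists_coeff_pow_mem_range_of_forall_map_eq (p : ℕ) [ExpChar K p] {F : L[X]}
    (hF : ∀ σ : L ≃ₐ[K] L, F.map (σ : L →+* L) = F) :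
    ∃ e₀, ∀ e, e₀ ≤ e → ∀ i, F.coeff i ^ p ^ e ∈ (algebraMap K L).range := by
  have hfix : ∀ i, ∀ σ : L ≃ₐ[K] L, σ (F.coeff i) = F.coeff i := fun i σ => by
    conv_rhs => rw [← hF σ]
    rw [Polynomial.coeff_map]
    rfl
  choose e he using fun i => exists_pow_mem_range_of_forall_algEquiv_eq p (hfix i)
  refine ⟨(Finset.range (F.natDegree + 1)).sup e, fun d hd i => ?_⟩
  by_cases hi : i < F.natDegree + 1
  · exact he i d ((Finset.le_sup (Finset.mem_range.mpr hi)).trans hd)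
  · rw [Polynomial.coeff_eq_zero_of_natDegree_lt (by omega),
      zero_pow (pow_ne_zero _ (expChar_pos K p).ne')]
    exact Subring.zero_mem _

end FixedPoints

section Henselian

variable [Algebra K L]

/-- Over a henselian valuation ring, a polynomial whose roots over an extension are integral, one
of them a unit residually equal to `1` and the others residually zero, has a root in the base. -/
theorem exists_algebraMap_eq_of_residue_eq_one_of_forall_lt_one {A : ValuationSubring K}
    [HenselianLocalRing A] {B : ValuationSubring L} (hB : B.comap (algebraMap K L) = A)
    {ι : Type*} (s : Finset ι) (z : ι → L) {i₀ : ι} (hi₀ : i₀ ∈ s)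
    (hz₀ : B.valuation (z i₀ - 1) < 1) (hz : ∀ i ∈ s, i ≠ i₀ → B.valuation (z i) < 1)
    {F : K[X]} (hF : F.map (algebraMap K L) = ∏ i ∈ s, (X - C (z i))) :
    ∃ a : K, algebraMap K L a = z i₀ := by
  set w := B.valuation with hw
  have hmemA : ∀ x : K, x ∈ A ↔ w (algebraMap K L x) ≤ 1 := fun x => by
    rw [hw, ValuationSubring.valuation_le_one_iff, ← ValuationSubring.mem_comap, hB]
  have hmaxA : ∀ x : A, x ∈ IsLocalRing.maximalIdeal A ↔ w (algebraMap K L x) < 1 := fun x => by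
    rw [ValuationSubring.valuation_lt_one_iff, ← not_le, ← not_le, not_iff_not]
    simpa using (valuation_algebraMap_le_iff hB 1 (x : K)).symm
  have hz₀' : w (z i₀) = 1 := by
    simpa using w.map_add_eq_of_lt_left (x := 1) (y := z i₀ - 1) (by simpa using hz₀)
  have hzB : ∀ i ∈ s, z i ∈ B := fun i hi => by
    rw [← ValuationSubring.valuation_le_one_iff]
    by_cases h : i = i₀
    · exact (h ▸ hz₀').le
    · exact (hz i hi h).le
  have hone : ∀ i ∈ s, i ≠ i₀ → w (1 - z i) = 1 := fun i hi h => by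
    simpa using w.map_sub_eq_of_lt_left (x := 1) (y := z i) (by simpa using hz i hi h)
  -- descend the complementary factor to the valuation ring of the extension
  let H : B[X] := ∏ i ∈ (s.erase i₀).attach,
    (X - C ⟨z i, hzB i (Finset.mem_of_mem_erase i.2)⟩)
  have hH : H.map B.subtype = ∏ i ∈ s.erase i₀, (X - C (z i)) := by
    rw [Polynomial.map_prod, ← Finset.prod_attach (s.erase i₀)]
    exact Finset.prod_congr rfl fun i _ => by simp
  let G : B[X] := (X - C ⟨z i₀, hzB i₀ hi₀⟩) * H
  have hG : G.map B.subtype = F.map (algebraMap K L) := by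
    rw [hF, ← Finset.mul_prod_erase s _ hi₀, Polynomial.map_mul, hH]
    simp
  have hcoeff : ∀ n, F.coeff n ∈ A := fun n => by
    rw [hmemA, ← Polynomial.coeff_map, ← hG, Polynomial.coeff_map,
      ValuationSubring.valuation_le_one_iff]
    exact (G.coeff n).2
  have hFlift : F ∈ Polynomial.lifts A.subtype := by
    rw [Polynomial.lifts_iff_coeff_lifts]
    exact fun n => ⟨⟨_, hcoeff n⟩, rfl⟩
  have hFmonic : F.Monic := by
    rw [← Polynomial.monic_map_iff (f := algebraMap K L), hF]
    exact Polynomial.monic_prod_of_monic _ _ fun i _ => Polynomial.monic_X_sub_C _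
  obtain ⟨f, hf, -, hfmonic⟩ := Polynomial.lifts_and_natDegree_eq_and_monic hFlift hFmonic
  have hmap : f.map ((algebraMap K L).comp A.subtype) = G.map B.subtype := by
    rw [hG, ← hf, Polynomial.map_map]
  have heval : ∀ (q : A[X]) (a : A), algebraMap K L (q.eval a : A) =
      (q.map ((algebraMap K L).comp A.subtype)).eval (algebraMap K L a) := fun q a =>
    (Polynomial.eval_map_apply ((algebraMap K L).comp A.subtype) a).symm
  have heval1 : ∀ q : B[X], (q.map B.subtype).eval 1 = (q.eval 1 : B) := fun q => by
    have := Polynomial.eval_map_apply (p := q) B.subtype 1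
    rwa [map_one] at this
  have hH1 : w (H.eval 1 : B) = 1 := by
    rw [← heval1, hH, Polynomial.eval_prod, map_prod]
    refine Finset.prod_eq_one fun i hi => ?_
    rw [Polynomial.eval_sub, Polynomial.eval_X, Polynomial.eval_C]
    exact hone i (Finset.mem_of_mem_erase hi) (Finset.ne_of_mem_erase hi)
  obtain ⟨a, ha, ha1⟩ := HenselianLocalRing.is_henselian f hfmonic 1 (by
      rw [hmaxA, heval, hmap, OneMemClass.coe_one, map_one, heval1]
      simp only [G, Polynomial.eval_mul, Polynomial.eval_sub, Polynomial.eval_X, Polynomial.eval_C,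
        MulMemClass.coe_mul, map_mul, hH1, mul_one]
      change w (1 - z i₀) < 1
      rwa [w.map_sub_swap]) (by
      rw [← not_not (a := IsUnit _), ← mem_nonunits_iff, ← IsLocalRing.mem_maximalIdeal, hmaxA,
        not_lt, heval, ← Polynomial.derivative_map, hmap, Polynomial.derivative_map,
        OneMemClass.coe_one, map_one, heval1]
      have hder : ((G.derivative.eval 1 : B) : L) =
          (H.eval 1 : B) - (z i₀ - 1) * (H.derivative.eval 1 : B) := by
        simp [G, Polynomial.derivative_mul]
        ring
      rw [hder, w.map_sub_eq_of_lt_left, hH1]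
      rw [hH1, map_mul]
      exact mul_lt_one_of_lt_of_le hz₀ ((ValuationSubring.valuation_le_one_iff _ _).mpr
        (H.derivative.eval 1).2))
  have hroot : ∏ i ∈ s, (algebraMap K L a - z i) = 0 := by
    have h := heval f a
    rw [ha.eq_zero, hmap, hG, hF, Polynomial.eval_prod] at h
    simpa using h.symm
  obtain ⟨i, hi, hai⟩ := Finset.prod_eq_zero_iff.mp hroot
  refine ⟨a, ?_⟩
  rw [sub_eq_zero] at hai
  by_cases h : i = i₀
  · rw [hai, h]
  · exfalso
    have h1 : w (algebraMap K L ((a - 1 : A) : K)) < 1 := (hmaxA _).mp ha1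
    have h2 := hone i hi h
    rw [← hai, w.map_sub_swap] at h2
    rw [AddSubgroupClass.coe_sub, map_sub, OneMemClass.coe_one, map_one, h2] at h1
    exact h1.false

/-- Uniqueness of the extension of a henselian valuation. -/
theorem valuation_algEquiv_eq [IsAlgClosed L] [Algebra.IsAlgebraic K L] (p : ℕ) [ExpChar K p]
    {A : ValuationSubring K} [HenselianLocalRing A] {B : ValuationSubring L}
    (hB : B.comap (algebraMap K L) = A) (σ : L ≃ₐ[K] L) (x : L) :
    B.valuation (σ x) = B.valuation x := by
  set w := B.valuation with hw
  have : ExpChar L p := expChar_of_injective_algebraMap (algebraMap K L).injective p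
  by_cases hx : x = 0
  · simp [hx]
  have hfin : (Set.range fun τ : L ≃ₐ[K] L => τ x).Finite := by
    refine ((minpoly K x).rootSet_finite L).subset ?_
    rintro _ ⟨τ, rfl⟩
    rw [Polynomial.mem_rootSet]
    refine ⟨minpoly.ne_zero (Algebra.IsIntegral.isIntegral x), ?_⟩
    change aeval (τ x) _ = 0
    rw [← minpoly.algEquiv_eq τ x, minpoly.aeval]
  let R : Finset L := hfin.toFinset
  have hR : ∀ y, y ∈ R ↔ ∃ τ : L ≃ₐ[K] L, τ x = y := fun y => by simp [R]
  have hRstable : ∀ τ : L ≃ₐ[K] L, ∀ y ∈ R, τ y ∈ R := fun τ y hy => by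
    obtain ⟨ρ, rfl⟩ := (hR y).mp hy
    exact (hR _).mpr ⟨ρ.trans τ, rfl⟩
  obtain ⟨y₀, hy₀, hmax⟩ := R.exists_max_image w ⟨x, (hR x).mpr ⟨AlgEquiv.refl, rfl⟩⟩
  set γ := w y₀ with hγ
  have hγ0 : γ ≠ 0 := by
    obtain ⟨τ, hτ⟩ := (hR y₀).mp hy₀
    rw [hγ, Valuation.ne_zero_iff, ← hτ]
    simpa using hx
  -- the conjugates of maximal value
  let S₀ : Finset L := R.filter fun y => w y = γ
  suffices hstable : ∀ τ : L ≃ₐ[K] L, S₀.image τ = S₀ by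
    have hall : ∀ τ : L ≃ₐ[K] L, w (τ x) = γ := fun τ => by
      obtain ⟨ρ, hρ⟩ := (hR y₀).mp hy₀
      have hmem : τ x ∈ S₀ := by
        rw [← hstable (ρ.symm.trans τ)]
        refine Finset.mem_image.mpr ⟨y₀, Finset.mem_filter.mpr ⟨hy₀, rfl⟩, ?_⟩
        simp [← hρ]
      exact (Finset.mem_filter.mp hmem).2
    rw [hall σ]
    exact (hall AlgEquiv.refl).symm
  let P := R.powersetCard S₀.card
  have hPstable : ∀ τ : L ≃ₐ[K] L, ∀ S ∈ P, S.image τ ∈ P := fun τ S hS => by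
    rw [Finset.mem_powersetCard] at hS ⊢
    refine ⟨fun y hy => ?_, by rw [Finset.card_image_of_injective _ τ.injective, hS.2]⟩
    obtain ⟨z, hz, rfl⟩ := Finset.mem_image.mp hy
    exact hRstable τ z (hS.1 hz)
  have hS₀P : S₀ ∈ P := Finset.mem_powersetCard.mpr ⟨Finset.filter_subset _ _, rfl⟩
  have hprodS₀ : w (∏ y ∈ S₀, y) = γ ^ S₀.card := by
    rw [map_prod]
    exact Finset.prod_eq_pow_card fun y hy => (Finset.mem_filter.mp hy).2
  have hprodlt : ∀ S ∈ P, S ≠ S₀ → w (∏ y ∈ S, y) < γ ^ S₀.card := fun S hS hne => by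
    rw [Finset.mem_powersetCard] at hS
    have hnot : ¬ S ⊆ S₀ := fun h => hne (Finset.eq_of_subset_of_card_le h hS.2.ge)
    obtain ⟨y, hyS, hy⟩ := Finset.not_subset.mp hnot
    have hlt : w y < γ := (hmax y (hS.1 hyS)).lt_of_ne fun h =>
      hy (Finset.mem_filter.mpr ⟨hS.1 hyS, h⟩)
    rw [map_prod, ← Finset.mul_prod_erase S _ hyS, ← hS.2, ← Finset.card_erase_add_one hyS,
      pow_succ']
    refine mul_lt_mul_of_lt_of_le_of_nonneg_of_pos hlt ?_ zero_le
      (pow_pos (zero_lt_iff.mpr hγ0) _)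
    exact Finset.prod_le_pow_card _ _ _ fun z hz => hmax z (hS.1 (Finset.mem_of_mem_erase hz))
  let E : L := ∑ S ∈ P, ∏ y ∈ S, y
  have himage : ∀ (τ : L ≃ₐ[K] L) (S : Finset L), ∏ y ∈ S.image τ, y = τ (∏ y ∈ S, y) :=
    fun τ S => by rw [Finset.prod_image τ.injective.injOn, map_prod]
  have hreindex : ∀ τ : L ≃ₐ[K] L, P.image (Finset.image τ) = P := fun τ => by
    refine Finset.eq_of_subset_of_card_le (fun S hS => ?_) ?_
    · obtain ⟨S', hS', rfl⟩ := Finset.mem_image.mp hS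
      exact hPstable τ S' hS'
    · rw [Finset.card_image_of_injective _ (Finset.image_injective τ.injective)]
  have hE : ∀ τ : L ≃ₐ[K] L, τ E = E := fun τ => by
    conv_rhs => rw [show E = ∑ S ∈ P, ∏ y ∈ S, y from rfl, ← hreindex τ]
    rw [Finset.sum_image (Finset.image_injective τ.injective).injOn, map_sum]
    exact Finset.sum_congr rfl fun S _ => (himage τ S).symm
  have hEsub : w (E - ∏ y ∈ S₀, y) < γ ^ S₀.card := by
    rw [show E = ∑ S ∈ P, ∏ y ∈ S, y from rfl, ← Finset.add_sum_erase P _ hS₀P,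
      add_sub_cancel_left]
    exact w.map_sum_lt (pow_ne_zero _ hγ0) fun S hS =>
      hprodlt S (Finset.mem_of_mem_erase hS) (Finset.ne_of_mem_erase hS)
  have hwE : w E = γ ^ S₀.card := by
    rw [← hprodS₀, ← sub_add_cancel E (∏ y ∈ S₀, y)]
    exact w.map_add_eq_of_lt_right (by rwa [hprodS₀])
  have hE0 : E ≠ 0 := by
    rw [← w.ne_zero_iff, hwE]
    exact pow_ne_zero _ hγ0
  let z : Finset L → L := fun S => (∏ y ∈ S, y) / E
  have hz : ∀ (τ : L ≃ₐ[K] L) (S : Finset L), z (S.image τ) = τ (z S) := fun τ S => by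
    simp only [z, himage, map_div₀, hE]
  have hz₀ : w (z S₀ - 1) < 1 := by
    rw [← div_self hE0, ← sub_div, map_div₀, w.map_sub_swap, hwE]
    exact (div_lt_one₀ (pow_pos (zero_lt_iff.mpr hγ0) _)).mpr hEsub
  have hzlt : ∀ S ∈ P, S ≠ S₀ → w (z S) < 1 := fun S hS hne => by
    rw [map_div₀, hwE]
    exact (div_lt_one₀ (pow_pos (zero_lt_iff.mpr hγ0) _)).mpr (hprodlt S hS hne)
  let F : L[X] := ∏ S ∈ P, (X - C (z S))
  have hF : ∀ τ : L ≃ₐ[K] L, F.map (τ : L →+* L) = F := fun τ => by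
    conv_rhs => rw [show F = ∏ S ∈ P, (X - C (z S)) from rfl, ← hreindex τ]
    rw [Finset.prod_image (Finset.image_injective τ.injective).injOn, Polynomial.map_prod]
    refine Finset.prod_congr rfl fun S _ => ?_
    rw [hz, Polynomial.map_sub, Polynomial.map_X, Polynomial.map_C]
    rfl
  obtain ⟨e, he⟩ := exists_coeff_pow_mem_range_of_forall_map_eq p hF
  obtain ⟨F₀, hF₀⟩ : F.map (iterateFrobenius L p e) ∈ Polynomial.lifts (algebraMap K L) := by
    rw [Polynomial.lifts_iff_coeff_lifts]
    intro n
    rw [Polynomial.coeff_map]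
    exact he e le_rfl n
  obtain ⟨a, ha⟩ := exists_algebraMap_eq_of_residue_eq_one_of_forall_lt_one hB P
    (fun S => z S ^ p ^ e) hS₀P (F := F₀) (by
      have : z S₀ ^ p ^ e - 1 = (z S₀ - 1) ^ p ^ e := by
        rw [sub_pow_expChar_pow, one_pow]
      rw [this, map_pow]
      exact pow_lt_one₀ zero_le hz₀ (pow_ne_zero _ (expChar_pos K p).ne')) (fun S hS hne => by
      rw [map_pow]
      exact pow_lt_one₀ zero_le (hzlt S hS hne) (pow_ne_zero _ (expChar_pos K p).ne')) (by
      rw [Polynomial.coe_mapRingHom] at hF₀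
      rw [hF₀, Polynomial.map_prod]
      exact Finset.prod_congr rfl fun S _ => by simp [iterateFrobenius_def])
  intro τ
  by_contra hne
  have h1 := hzlt _ (hPstable τ S₀ hS₀P) hne
  have h2 : z (S₀.image τ) ^ p ^ e = z S₀ ^ p ^ e := by
    rw [hz, ← map_pow, ← ha, τ.commutes]
  have h3 : w (z S₀) = 1 := by
    simpa using w.map_add_eq_of_lt_left (x := 1) (y := z S₀ - 1) (by simpa using hz₀)
  have h4 := pow_lt_one₀ zero_le h1 (pow_ne_zero e (expChar_pos K p).ne')
  rw [← map_pow, h2, map_pow, h3, one_pow] at h4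
  exact h4.false

end Henselian

section AdditivePolynomial

/-- The polynomial vanishing exactly on a finite additive subgroup in characteristic `p` is an
additive polynomial. -/
theorem exists_prod_X_sub_C_eq_sum (p : ℕ) [Fact p.Prime] [CharP L p] (S : Finset L)
    (hzero : 0 ∈ S) (hsub : ∀ u ∈ S, ∀ v ∈ S, u - v ∈ S) :
    ∃ (n : ℕ) (co : ℕ → L),
      ∏ u ∈ S, (X - C u) = ∑ i ∈ Finset.range (n + 1), C (co i) * X ^ p ^ i := by
  let : Algebra (ZMod p) L := ZMod.algebra L p
  have hneg : ∀ u ∈ S, -u ∈ S := fun u hu => by simpa using hsub 0 hzero u hu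
  let V : AddSubgroup L :=
    { carrier := S
      zero_mem' := hzero
      add_mem' := fun {u v} hu hv => by simpa using hsub u hu (-v) (hneg v hv)
      neg_mem' := fun {u} hu => hneg u hu }
  let M : Submodule (ZMod p) L := AddSubgroup.toZModSubmodule p V
  have hM : ∀ u, u ∈ M ↔ u ∈ S := fun u => Iff.rfl
  let eM : M ≃ S := Equiv.subtypeEquivRight hM
  have : Finite M := Finite.of_equiv _ eM.symm
  set n := Module.finrank (ZMod p) M with hn
  have hcard : S.card = p ^ n := by
    have h := Module.natCard_eq_pow_finrank (K := ZMod p) (V := M)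
    rw [Nat.card_congr eM, Nat.card_zmod] at h
    simpa using h
  let b := Module.finBasis (ZMod p) M
  have hdep : ¬ LinearIndependent L
      (fun (i : Fin (n + 1)) (j : Fin n) => (b j : L) ^ p ^ (i : ℕ)) := fun h => by
    have := h.fintype_card_le_finrank
    simp at this
  obtain ⟨g, hg, i₀, hi₀⟩ := Fintype.not_linearIndependent_iff.mp hdep
  let co : ℕ → L := fun i => if h : i < n + 1 then g ⟨i, h⟩ else 0
  have hco : ∀ i : Fin (n + 1), co i = g i := fun i => dif_pos i.2
  let Q : L[X] := ∑ i ∈ Finset.range (n + 1), C (co i) * X ^ p ^ i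
  have hQeval : ∀ x, Q.eval x = ∑ i ∈ Finset.range (n + 1), co i * x ^ p ^ i := fun x => by
    simp [Q, Polynomial.eval_finsetSum]
  have hp : 1 < p := (Fact.out : p.Prime).one_lt
  have hQ0 : Q ≠ 0 := fun h => by
    have h1 : Q.coeff (p ^ (i₀ : ℕ)) = g i₀ := by
      simp only [Q, Polynomial.finsetSum_coeff, Polynomial.coeff_C_mul, Polynomial.coeff_X_pow]
      rw [Finset.sum_eq_single (i₀ : ℕ)]
      · simp [hco]
      · intro i _ hi
        rw [if_neg fun h => hi ((Nat.pow_right_injective hp h).symm), mul_zero]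
      · intro h
        exact absurd (Finset.mem_range.mpr i₀.2) h
    rw [h, Polynomial.coeff_zero] at h1
    exact hi₀ h1.symm
  have hQdeg : Q.natDegree ≤ p ^ n := by
    refine Polynomial.natDegree_sum_le_of_forall_le _ _ fun i hi => ?_
    refine (Polynomial.natDegree_C_mul_X_pow_le _ _).trans ?_
    exact Nat.pow_le_pow_right hp.le (Nat.lt_succ_iff.mp (Finset.mem_range.mp hi))
  let W : AddSubgroup L :=
    { carrier := {x | Q.eval x = 0}
      zero_mem' := by
        simp [hQeval, zero_pow (pow_ne_zero _ (Fact.out : p.Prime).ne_zero)]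
      add_mem' := fun {x y} hx hy => by
        simp only [Set.mem_ofPred_eq, hQeval] at hx hy ⊢
        simp only [add_pow_char_pow, mul_add, Finset.sum_add_distrib, hx, hy, add_zero]
      neg_mem' := fun {x} hx => by
        simp only [Set.mem_ofPred_eq, hQeval] at hx ⊢
        have : ∀ i, (-x) ^ p ^ i = -(x ^ p ^ i) := fun i => by
          rw [← zero_sub, sub_pow_char_pow,
            zero_pow (pow_ne_zero _ (Fact.out : p.Prime).ne_zero), zero_sub]
        simp only [this, mul_neg, Finset.sum_neg_distrib, hx, neg_zero] }
  have hroot : ∀ u ∈ S, Q.eval u = 0 := by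
    have hle : M ≤ AddSubgroup.toZModSubmodule p W := by
      rw [← Submodule.map_subtype_top M, ← b.span_eq, Submodule.map_span, Submodule.span_le]
      rintro _ ⟨_, ⟨j, rfl⟩, rfl⟩
      change Q.eval (b j : L) = 0
      rw [hQeval, Finset.sum_range]
      simp only [hco]
      simpa using congrFun hg j
    exact fun u hu => hle ((hM u).mpr hu)
  have hdvd : ∏ u ∈ S, (X - C u) ∣ Q := by
    have := (Multiset.prod_X_sub_C_dvd_iff_le_roots hQ0 S.val).mpr
      ((Multiset.le_iff_subset S.nodup).mpr fun u hu =>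
        (Polynomial.mem_roots hQ0).mpr (hroot u hu))
    exact this
  obtain ⟨D, hD⟩ := hdvd
  have hmonic : (∏ u ∈ S, (X - C u)).Monic :=
    Polynomial.monic_prod_of_monic _ _ fun i _ => Polynomial.monic_X_sub_C _
  have hD0 : D ≠ 0 := by
    rintro rfl
    exact hQ0 (by rw [hD, mul_zero])
  have hDdeg : D.natDegree = 0 := by
    have h := congrArg Polynomial.natDegree hD
    rw [hmonic.natDegree_mul' hD0, Polynomial.natDegree_finsetProd_X_sub_C_eq_card, hcard] at h
    omega
  obtain ⟨d, rfl⟩ := Polynomial.natDegree_eq_zero.mp hDdeg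
  have hd0 : d ≠ 0 := by simpa using hD0
  refine ⟨n, fun i => co i * d⁻¹, ?_⟩
  have h : ∏ u ∈ S, (X - C u) = Q * C d⁻¹ := by
    rw [hD, mul_assoc, ← Polynomial.C_mul, mul_inv_cancel₀ hd0, Polynomial.C_1, mul_one]
  rw [h, Finset.sum_mul]
  refine Finset.sum_congr rfl fun i _ => ?_
  rw [Polynomial.C_mul]
  ring

/-- A Galois-stable finite additive subgroup is, up to a power of Frobenius, the kernel of an
additive polynomial over the base field. -/
theorem exists_sum_eq_prod_sub_pow [Algebra K L] [IsAlgClosed L] [Algebra.IsAlgebraic K L]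
    (p : ℕ) [Fact p.Prime] [CharP K p] (S : Finset L)
    (hzero : 0 ∈ S) (hsub : ∀ u ∈ S, ∀ v ∈ S, u - v ∈ S)
    (hstable : ∀ σ : L ≃ₐ[K] L, ∀ u ∈ S, σ u ∈ S) :
    ∃ e₀, ∀ e, e₀ ≤ e → ∃ (m : ℕ) (co : ℕ → K), ∀ x : L,
      ∑ i ∈ Finset.range (m + 1), algebraMap K L (co i) * x ^ p ^ i =
        (∏ u ∈ S, (x - u)) ^ p ^ e := by
  have : CharP L p := charP_of_injective_algebraMap (algebraMap K L).injective p
  obtain ⟨n, co, hco⟩ := exists_prod_X_sub_C_eq_sum p S hzero hsub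
  have hp : 1 < p := (Fact.out : p.Prime).one_lt
  have himage : ∀ σ : L ≃ₐ[K] L, S.image σ = S := fun σ =>
    Finset.eq_of_subset_of_card_le (Finset.image_subset_iff.mpr (hstable σ))
      (Finset.card_image_of_injective _ σ.injective).ge
  obtain ⟨e₀, he₀⟩ := exists_coeff_pow_mem_range_of_forall_map_eq (K := K) p
    (F := ∏ u ∈ S, (X - C u)) fun σ => by
      conv_rhs => rw [← himage σ, Finset.prod_image σ.injective.injOn]
      rw [Polynomial.map_prod]
      refine Finset.prod_congr rfl fun S _ => ?_
      rw [Polynomial.map_sub, Polynomial.map_X, Polynomial.map_C]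
      rfl
  refine ⟨e₀, fun e he => ?_⟩
  have hcoeff : ∀ i ∈ Finset.range (n + 1), (∏ u ∈ S, (X - C u)).coeff (p ^ i) = co i := by
    intro i hi
    rw [hco, Polynomial.finsetSum_coeff, Finset.sum_eq_single i]
    · simp
    · intro j _ hj
      rw [Polynomial.coeff_C_mul, Polynomial.coeff_X_pow,
        if_neg fun h => hj (Nat.pow_right_injective hp h).symm, mul_zero]
    · exact fun h => absurd hi h
  choose c hc using fun i => he₀ e he (p ^ i)
  refine ⟨e + n, fun j => if j < e then 0 else c (j - e), fun x => ?_⟩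
  have hx : ∏ u ∈ S, (x - u) = ∑ i ∈ Finset.range (n + 1), co i * x ^ p ^ i := by
    simpa [Polynomial.eval_prod, Polynomial.eval_finsetSum] using congrArg (Polynomial.eval x) hco
  rw [hx, sum_pow_char_pow, add_assoc, Finset.sum_range_add, Finset.sum_eq_zero, zero_add]
  · refine Finset.sum_congr rfl fun i hi => ?_
    beta_reduce
    rw [if_neg (by omega : ¬ e + i < e), Nat.add_sub_cancel_left, hc, hcoeff i hi, mul_pow,
      ← pow_mul, ← pow_add, add_comm]
  · intro i hi
    simp [Finset.mem_range.mp hi]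

end AdditivePolynomial

section Extremal

variable [Algebra K L]

/-- For a finite additive subgroup `S` none of whose elements is approximated from `K` as well as
`r - a₀` is, some `a` close to `r` is closer to `r + S` than `a₀`. -/
theorem exists_prod_valuation_lt {Γ : Type*} [LinearOrderedCommGroupWithZero Γ]
    (w : Valuation L Γ) (S : Finset L) (hzero : 0 ∈ S) (hsub : ∀ u ∈ S, ∀ v ∈ S, u - v ∈ S)
    {r : L} (hr : ∀ a : K, ∃ b : K, w (r - algebraMap K L b) < w (r - algebraMap K L a))
    (hS : ∀ u ∈ S, ∃ a : K, ∀ b : K, w (u - algebraMap K L a) ≤ w (u - algebraMap K L b))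
    (a₀ : K) :
    ∃ a : K, w (r - algebraMap K L a) ≤ w r ∧
      w (∏ u ∈ S, (r - algebraMap K L a - u)) < w (∏ u ∈ S, (r - algebraMap K L a₀ - u)) := by
  set y := r - algebraMap K L a₀ with hy
  have hclose : ∀ u ∈ S, ∃ a : K, w (r - algebraMap K L a) < w (y - u) := fun u hu => by
    by_contra! hlim
    obtain ⟨a, ha⟩ := hS u hu
    have hlt : ∀ c : K, w (y - u) < w (y - algebraMap K L c) := fun c => by
      obtain ⟨b, hb⟩ := hr (a₀ + c)
      rw [map_add, ← sub_sub] at hb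
      exact (hlim b).trans_lt hb
    have heq : ∀ c : K, w (u - algebraMap K L c) = w (y - algebraMap K L c) := fun c => by
      have : u - algebraMap K L c = (y - algebraMap K L c) - (y - u) := by ring
      rw [this, w.map_sub_eq_of_lt_left (hlt c)]
    obtain ⟨b, hb⟩ := hr (a₀ + a)
    have h := ha (b - a₀)
    have ha' : y - algebraMap K L a = r - algebraMap K L (a₀ + a) := by
      rw [hy, map_add]
      ring
    have hb' : y - algebraMap K L (b - a₀) = r - algebraMap K L b := by
      rw [hy, map_sub]
      ring
    rw [heq, heq, ha', hb'] at h
    exact hb.not_ge h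
  choose! c hc using hclose
  obtain ⟨a, -, ha⟩ := Finset.exists_min_image (insert 0 (S.image c))
    (fun a => w (r - algebraMap K L a)) (Finset.insert_nonempty _ _)
  have ha0 := ha 0 (Finset.mem_insert_self _ _)
  have hlt : ∀ u ∈ S, w (r - algebraMap K L a) < w (y - u) := fun u hu =>
    (ha _ (Finset.mem_insert_of_mem (Finset.mem_image_of_mem c hu))).trans_lt (hc u hu)
  refine ⟨a, by simpa using ha0, ?_⟩
  set x := r - algebraMap K L a
  obtain ⟨u₀, hu₀, hmin⟩ := S.exists_min_image (fun u => w (y - u)) ⟨0, hzero⟩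
  have hneg : ∀ u ∈ S, -u ∈ S := fun u hu => by simpa using hsub 0 hzero u hu
  have hadd : ∀ u ∈ S, ∀ v ∈ S, u + v ∈ S := fun u hu v hv => by
    simpa using hsub u hu (-v) (hneg v hv)
  have hshift : ∏ u ∈ S, (y - u) = ∏ u ∈ S, (y - u₀ - u) := by
    refine Finset.prod_bij' (fun u _ => u - u₀) (fun u _ => u + u₀)
      (fun u hu => hsub u hu u₀ hu₀) (fun u hu => hadd u hu u₀ hu₀) ?_ ?_ ?_ <;> intros <;> ring
  have hlt' : ∀ u ∈ S, w x < w (y - u₀ - u) := fun u hu => by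
    rw [sub_sub]
    exact hlt _ (hadd u₀ hu₀ u hu)
  have hle : ∀ u ∈ S, w (x - u) ≤ w (y - u₀ - u) := fun u hu => by
    have hy' : w (y - u₀) ≤ w (y - u₀ - u) := by
      rw [sub_sub y]
      exact hmin _ (hadd u₀ hu₀ u hu)
    have hu' : w u ≤ w (y - u₀ - u) := by
      rw [← sub_sub_cancel (y - u₀) u]
      exact (w.map_sub _ _).trans (by rw [sub_sub_cancel]; exact max_le hy' le_rfl)
    exact (w.map_sub _ _).trans (max_le (hlt' u hu).le hu')
  rw [hshift, map_prod, map_prod, ← Finset.mul_prod_erase S _ hzero,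
    ← Finset.mul_prod_erase S (fun u => w (y - u₀ - u)) hzero]
  refine mul_lt_mul_of_lt_of_le_of_nonneg_of_pos ?_ ?_ zero_le ?_
  · simpa using hlt' 0 hzero
  · exact Finset.prod_le_prod' fun u hu => hle u (Finset.mem_of_mem_erase hu)
  · exact Finset.prod_pos fun u hu =>
      zero_le.trans_lt (hlt' u (Finset.mem_of_mem_erase hu))

end Extremal

section BestApproximation

theorem exists_valuation_sum_sub_le {A : ValuationSubring K} {p : ℕ}
    (hE : ∀ f : K[X], IsPPolynomial p f → OExtremal A f) (m : ℕ) (co : ℕ → K) (c d : K) :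
    ∃ b : K, ∀ a : K, A.valuation a ≤ A.valuation d →
      A.valuation (∑ i ∈ Finset.range (m + 1), co i * b ^ p ^ i - c) ≤
        A.valuation (∑ i ∈ Finset.range (m + 1), co i * a ^ p ^ i - c) := by
  set f : K[X] := C (-c) + ∑ i ∈ Finset.range (m + 1), C (co i * d ^ p ^ i) * X ^ p ^ i with hf
  obtain ⟨a₀, ha₀⟩ := hE f ⟨_, m, _, hf⟩
  have heval : ∀ a : K,
      f.eval a = ∑ i ∈ Finset.range (m + 1), co i * (d * a) ^ p ^ i - c := fun a => by
    simp [hf, Polynomial.eval_finsetSum, mul_pow, mul_assoc, neg_add_eq_sub]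
  refine ⟨d * a₀, fun a ha => ?_⟩
  obtain ⟨b, rfl⟩ : ∃ b : A, d * b = a := by
    rcases eq_or_ne d 0 with rfl | hd
    · exact ⟨0, by simp_all⟩
    · refine ⟨⟨a / d, ?_⟩, mul_div_cancel₀ a hd⟩
      rw [← A.valuation_le_one_iff, map_div₀]
      exact div_le_one_of_le₀ ha zero_le
  simpa only [heval] using ha₀ b

variable [Algebra K L] [IsAlgClosed L] [Algebra.IsAlgebraic K L]

theorem exists_best_approx_of_forall_algEquiv_sub_mem (p : ℕ) [Fact p.Prime] [CharP K p]
    {A : ValuationSubring K} [HenselianLocalRing A]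
    (hE : ∀ f : K[X], IsPPolynomial p f → OExtremal A f)
    {B : ValuationSubring L} (hB : B.comap (algebraMap K L) = A) (S : Finset L)
    (hzero : 0 ∈ S) (hsub : ∀ u ∈ S, ∀ v ∈ S, u - v ∈ S)
    (hstable : ∀ σ : L ≃ₐ[K] L, ∀ u ∈ S, σ u ∈ S)
    {r : L} (hr : ∀ σ : L ≃ₐ[K] L, σ r - r ∈ S) :
    ∃ a : K, ∀ b : K,
      B.valuation (r - algebraMap K L a) ≤ B.valuation (r - algebraMap K L b) := by
  have : CharP L p := charP_of_injective_algebraMap (algebraMap K L).injective p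
  have hinv := valuation_algEquiv_eq p hB
  have hval := valuation_algebraMap_le_iff hB
  induction hn : S.card using Nat.strong_induction_on generalizing S r with
  | _ n ih =>
  by_contra! hlim
  have hS : ∀ t ∈ S, ∃ a : K, ∀ b : K,
      B.valuation (t - algebraMap K L a) ≤ B.valuation (t - algebraMap K L b) := fun t ht => by
    by_cases ht0 : ∀ b : K, B.valuation t ≤ B.valuation (t - algebraMap K L b)
    · exact ⟨0, by simpa using ht0⟩
    push Not at ht0
    obtain ⟨a, ha⟩ := ht0
    refine ih _ ?_ (S.filter fun u => B.valuation u < B.valuation t) ?_ ?_ ?_ ?_ rfl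
    · rw [← hn]
      exact Finset.card_lt_card (Finset.filter_ssubset.mpr ⟨t, ht, lt_irrefl _⟩)
    · refine Finset.mem_filter.mpr ⟨hzero, ?_⟩
      rw [map_zero]
      exact zero_le.trans_lt ha
    · intro u hu v hv
      rw [Finset.mem_filter] at hu hv ⊢
      exact ⟨hsub u hu.1 v hv.1, (B.valuation.map_sub _ _).trans_lt (max_lt hu.2 hv.2)⟩
    · intro σ u hu
      rw [Finset.mem_filter] at hu ⊢
      exact ⟨hstable σ u hu.1, (hinv σ u).trans_lt hu.2⟩
    · refine fun σ => Finset.mem_filter.mpr ⟨hsub _ (hstable σ t ht) t ht, ?_⟩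
      have hσ : B.valuation (σ t - algebraMap K L a) = B.valuation (t - algebraMap K L a) := by
        rw [← hinv σ (t - algebraMap K L a), map_sub σ, σ.commutes]
      rw [← sub_sub_sub_cancel_right (σ t) t (algebraMap K L a)]
      exact (B.valuation.map_sub _ _).trans_lt (max_lt (hσ.trans_lt ha) ha)
  have hfix : ∀ σ : L ≃ₐ[K] L, σ (∏ u ∈ S, (r - u)) = ∏ u ∈ S, (r - u) := fun σ => by
    rw [map_prod]
    refine Finset.prod_bij (fun u _ => σ u - (σ r - r))
      (fun u hu => hsub _ (hstable σ u hu) _ (hr σ)) (fun u _ v _ h => ?_) (fun u hu => ?_)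
      (fun u _ => ?_)
    · exact σ.injective (sub_left_injective h)
    · refine ⟨σ.symm (u + (σ r - r)), ?_, by simp⟩
      have h := hsub u hu _ (hsub 0 hzero _ (hr σ))
      rw [zero_sub, sub_neg_eq_add] at h
      exact hstable σ.symm _ h
    · rw [map_sub]
      ring
  obtain ⟨e₁, he₁⟩ := exists_sum_eq_prod_sub_pow (K := K) p S hzero hsub hstable
  obtain ⟨e₂, he₂⟩ := exists_pow_mem_range_of_forall_algEquiv_eq p hfix
  obtain ⟨c, hc⟩ := he₂ _ (le_max_right e₁ e₂)
  obtain ⟨m, co, hco⟩ := he₁ _ (le_max_left e₁ e₂)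
  set e := max e₁ e₂
  have hdist : ∀ a : K, B.valuation (∏ u ∈ S, (r - algebraMap K L a - u)) ^ p ^ e =
      B.valuation (algebraMap K L (∑ i ∈ Finset.range (m + 1), co i * a ^ p ^ i - c)) :=
    fun a => by
      have h : algebraMap K L (∑ i ∈ Finset.range (m + 1), co i * a ^ p ^ i - c) =
          -(∏ u ∈ S, (r - algebraMap K L a - u)) ^ p ^ e := by
        rw [map_sub, hc, ← hco, ← hco, map_sum, ← Finset.sum_sub_distrib,
          ← Finset.sum_neg_distrib]
        refine Finset.sum_congr rfl fun i _ => ?_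
        rw [sub_pow_char_pow, map_mul, map_pow]
        ring
      rw [h, Valuation.map_neg, map_pow]
  obtain ⟨d, hd⟩ := hlim 0
  have hdr : B.valuation (algebraMap K L d) = B.valuation r := by
    rw [map_zero, sub_zero] at hd
    rw [← sub_sub_cancel r (algebraMap K L d), B.valuation.map_sub_eq_of_lt_left hd]
  obtain ⟨a₀, ha₀⟩ := exists_valuation_sum_sub_le hE m co c d
  obtain ⟨a, har, ha⟩ := exists_prod_valuation_lt B.valuation S hzero hsub hlim hS a₀
  have had : A.valuation a ≤ A.valuation d := by
    rw [← hval, hdr, ← sub_sub_cancel r (algebraMap K L a)]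
    exact (B.valuation.map_sub _ _).trans (max_le le_rfl har)
  have h := (hval _ _).mpr (ha₀ a had)
  rw [← hdist, ← hdist] at h
  exact (pow_lt_pow_left₀ ha zero_le (pow_ne_zero _ (Fact.out : p.Prime).ne_zero)).not_ge h

end BestApproximation

section Immediate

theorem exists_valuation_sub_lt_of_isImmediate [Algebra K L] {B : ValuationSubring L}
    (hB : IsImmediate K B) {r : L} (hr : ∀ a, algebraMap K L a ≠ r) (a : K) :
    ∃ b : K, B.valuation (r - algebraMap K L b) < B.valuation (r - algebraMap K L a) := by
  have hy : r - algebraMap K L a ≠ 0 := sub_ne_zero.mpr (hr a).symm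
  obtain ⟨c, hc⟩ := hB.1 _ hy
  have hc0 : algebraMap K L c ≠ 0 := by
    rw [← B.valuation.ne_zero_iff, ← hc]
    exact B.valuation.ne_zero_iff.mpr hy
  obtain ⟨d, hd⟩ := hB.2 ((r - algebraMap K L a) / algebraMap K L c) (by
    rw [map_div₀, hc]
    exact div_self_le_one _)
  refine ⟨a + c * d, ?_⟩
  have h : r - algebraMap K L (a + c * d) =
      algebraMap K L c * ((r - algebraMap K L a) / algebraMap K L c - algebraMap K L d) := by
    rw [map_add, map_mul]
    field_simp
    ring
  rw [h, map_mul, hc]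
  exact mul_lt_of_lt_one_right (zero_lt_iff.mpr (B.valuation.ne_zero_iff.mpr hc0)) hd

/-- The differences between the conjugates of `r` and `r` lie in a Galois-stable finite additive
subgroup. -/
theorem exists_finset_forall_algEquiv_sub_mem [Algebra K L] [Algebra.IsAlgebraic K L] (p : ℕ)
    [Fact p.Prime] [CharP K p] (r : L) :
    ∃ S : Finset L, 0 ∈ S ∧ (∀ u ∈ S, ∀ v ∈ S, u - v ∈ S) ∧
      (∀ σ : L ≃ₐ[K] L, ∀ u ∈ S, σ u ∈ S) ∧ ∀ σ : L ≃ₐ[K] L, σ r - r ∈ S := by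
  have : CharP L p := charP_of_injective_algebraMap (algebraMap K L).injective p
  let : Algebra (ZMod p) L := ZMod.algebra L p
  let T : Set L := Set.range fun σ : L ≃ₐ[K] L => σ r - r
  have hT : T.Finite := by
    refine (((minpoly K r).rootSet_finite L).image fun x => x - r).subset ?_
    rintro _ ⟨σ, rfl⟩
    refine ⟨σ r, ?_, rfl⟩
    rw [Polynomial.mem_rootSet]
    refine ⟨minpoly.ne_zero (Algebra.IsIntegral.isIntegral r), ?_⟩
    rw [Polynomial.aeval_algHom_apply σ, minpoly.aeval, map_zero]
  let M := Submodule.span (ZMod p) T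
  have : Module.Finite (ZMod p) M := Module.Finite.span_of_finite _ hT
  have : Finite M := Module.finite_of_finite (ZMod p)
  have hfin : (M : Set L).Finite := this
  refine ⟨hfin.toFinset, by simp, fun u hu v hv => ?_, fun σ u hu => ?_, fun σ => ?_⟩
  · rw [hfin.mem_toFinset] at hu hv ⊢
    exact M.sub_mem hu hv
  · rw [hfin.mem_toFinset] at hu ⊢
    induction hu using Submodule.span_induction with
    | mem x hx =>
      obtain ⟨τ, rfl⟩ := hx
      have h : σ (τ r - r) = (σ * τ) r - r - (σ r - r) := by
        rw [map_sub, AlgEquiv.mul_apply]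
        ring
      rw [h]
      exact M.sub_mem (Submodule.subset_span ⟨_, rfl⟩) (Submodule.subset_span ⟨_, rfl⟩)
    | zero => simp
    | add x y _ _ hx hy =>
      rw [map_add]
      exact M.add_mem hx hy
    | smul c x _ hx =>
      rw [ZMod.map_smul]
      exact M.smul_mem c hx
  · rw [hfin.mem_toFinset]
    exact Submodule.subset_span ⟨σ, rfl⟩

end Immediate

theorem isAlgMaximal_of_forall_oExtremal (p : ℕ) [Fact p.Prime] [CharP K p]
    {A : ValuationSubring K} [HenselianLocalRing A]
    (hE : ∀ f : K[X], IsPPolynomial p f → OExtremal A f) : IsAlgMaximal A := by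
  intro L _ _ hL B hB himm r
  by_contra! hr
  let Ω := AlgebraicClosure L
  have : Algebra.IsAlgebraic K Ω := Algebra.IsAlgebraic.trans K L Ω
  obtain ⟨B', hB'⟩ := exists_valuationSubring_comap_eq (L := Ω) B
  obtain ⟨S, hzero, hsub, hstable, hS⟩ :=
    exists_finset_forall_algEquiv_sub_mem (K := K) p (algebraMap L Ω r)
  have hcomap : B'.comap (algebraMap K Ω) = A := by
    rw [IsScalarTower.algebraMap_eq K L Ω, ← ValuationSubring.comap_comap, hB', hB]
  obtain ⟨a, ha⟩ :=
    exists_best_approx_of_forall_algEquiv_sub_mem p hE hcomap S hzero hsub hstable hS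
  obtain ⟨b, hb⟩ := exists_valuation_sub_lt_of_isImmediate himm hr a
  have h := ha b
  rw [IsScalarTower.algebraMap_apply K L Ω, IsScalarTower.algebraMap_apply K L Ω, ← map_sub,
    ← map_sub, valuation_algebraMap_le_iff hB'] at h
  exact hb.not_ge h

/-- A henselian valued field of characteristic `p > 0` is algebraically maximal if and only if
it is `O`-extremal with respect to every `p`-polynomial in one variable. -/
theorem statement3 {K : Type u} [Field K] (p : ℕ) (hp : 0 < p) [CharP K p]
    (A : ValuationSubring K) [HenselianLocalRing A] :
    IsAlgMaximal A ↔ ∀ f : Polynomial K, IsPPolynomial p f → OExtremal A f := by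
  have : Fact p.Prime := ⟨(CharP.char_is_prime_or_zero K p).resolve_right hp.ne'⟩
  exact ⟨fun hA f _ => hA.oExtremal f, isAlgMaximal_of_forall_oExtremal p⟩

end ValuedDefect
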